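/- Under the pre-treatment factor model and the post-treatment surrogate factor model with Γα = β and Φγ = θ, the two representations of the average treatment effect on the treated agree: E[Y1 − ⟪W, α⟫] = E[⟪X, γ⟫], and both equal E[Y1 − Y0]. -/

import Mathlib

open MeasureTheory Matrix

/-- A random variable with vanishing conditional expectation has mean zero. -/
theorem integral_eq_zero_of_condExp_ae_eq_zero {Ω : Type*} {m m₀ : MeasurableSpace Ω}
    {P : Measure Ω} [IsFiniteMeasure P] (hm : m ≤ m₀) {f : Ω → ℝ} (hf : P[f | m] =ᵐ[P] 0) :
    ∫ ω, f ω ∂P = 0 := by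
  rw [← integral_condExp hm, integral_congr_ae hf]
  simp

theorem integrable_dotProduct_const {Ω ι : Type*} [Fintype ι] [MeasurableSpace Ω]
    {P : Measure Ω} {e : Ω → ι → ℝ} (he : ∀ i, Integrable (fun ω => e ω i) P) (v : ι → ℝ) :
    Integrable (fun ω => e ω ⬝ᵥ v) P :=
  integrable_finsetSum _ fun i _ => (he i).mul_const (v i)

theorem integral_dotProduct_const_eq_zero {Ω ι : Type*} [Fintype ι] [MeasurableSpace Ω]
    {P : Measure Ω} {e : Ω → ι → ℝ} (he : ∀ i, Integrable (fun ω => e ω i) P)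
    (h0 : ∀ i, ∫ ω, e ω i ∂P = 0) (v : ι → ℝ) : ∫ ω, e ω ⬝ᵥ v ∂P = 0 := by
  simp only [dotProduct]
  rw [integral_finsetSum _ fun i _ => (he i).mul_const (v i)]
  simp [integral_mul_const, h0]

/-- A scalar outcome and a weighted vector of outcomes with the same factor loadings and mean-zero
errors have the same mean. -/
theorem integral_weighted_outcome_eq {Ω ι κ : Type*} [Fintype ι] [Fintype κ] [MeasurableSpace Ω]
    {P : Measure Ω} {l : Ω → ι → ℝ} {A : Matrix ι κ ℝ} {b : ι → ℝ} {y u : Ω → ℝ}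
    {z e : Ω → κ → ℝ} (hl : ∀ i, Integrable (fun ω => l ω i) P)
    (hy : ∀ ω, y ω = l ω ⬝ᵥ b + u ω) (hz : ∀ ω, z ω = Aᵀ *ᵥ l ω + e ω)
    (hu : Integrable u P) (he : ∀ i, Integrable (fun ω => e ω i) P)
    (hu0 : ∫ ω, u ω ∂P = 0) (he0 : ∀ i, ∫ ω, e ω i ∂P = 0)
    {v : κ → ℝ} (hv : A *ᵥ v = b) : ∫ ω, z ω ⬝ᵥ v ∂P = ∫ ω, y ω ∂P := by
  have hzv (ω : Ω) : z ω ⬝ᵥ v = l ω ⬝ᵥ b + e ω ⬝ᵥ v := by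
    rw [hz, add_dotProduct, mulVec_transpose, ← dotProduct_mulVec, hv]
  have hlb := integrable_dotProduct_const hl b
  simp only [hzv, hy]
  rw [integral_add hlb (integrable_dotProduct_const he v), integral_add hlb hu,
    integral_dotProduct_const_eq_zero he he0, hu0]

/-- Under the pre-treatment factor model and the post-treatment surrogate factor
model with Γα = β and Φγ = θ, the two representations of the ATT agree:
E[Y1 − ⟪W, α⟫] = E[⟪X, γ⟫], and both equal E[Y1 − Y0]. -/
theorem sc_att_two_representations
    {Ω : Type*} [MeasurableSpace Ω] (P : Measure Ω) [IsProbabilityMeasure P]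
    {F N K H : ℕ}
    (lam : Ω → Fin F → ℝ) (β : Fin F → ℝ) (Γ : Matrix (Fin F) (Fin N) ℝ)
    (rho : Ω → Fin K → ℝ) (θ : Fin K → ℝ) (Φ : Matrix (Fin K) (Fin H) ℝ)
    (Y0 Y1 : Ω → ℝ) (W : Ω → Fin N → ℝ) (X : Ω → Fin H → ℝ)
    (εY : Ω → ℝ) (εW : Ω → Fin N → ℝ) (δ : Ω → ℝ) (εX : Ω → Fin H → ℝ)
    (hlam : Measurable lam) (hrho : Measurable rho)
    (hY0 : ∀ ω, Y0 ω = lam ω ⬝ᵥ β + εY ω)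
    (hW : ∀ ω, W ω = Γ.transpose.mulVec (lam ω) + εW ω)
    (hY1 : ∀ ω, Y1 ω - Y0 ω = rho ω ⬝ᵥ θ + δ ω)
    (hX : ∀ ω, X ω = Φ.transpose.mulVec (rho ω) + εX ω)
    (hεY : P[εY | MeasurableSpace.comap (fun ω => (lam ω, rho ω)) inferInstance] =ᵐ[P] 0)
    (hεW : ∀ i, P[(fun ω => εW ω i) |
      MeasurableSpace.comap (fun ω => (lam ω, rho ω)) inferInstance] =ᵐ[P] 0)
    (hδ : P[δ | MeasurableSpace.comap (fun ω => (lam ω, rho ω)) inferInstance] =ᵐ[P] 0)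
    (hεX : ∀ i, P[(fun ω => εX ω i) |
      MeasurableSpace.comap (fun ω => (lam ω, rho ω)) inferInstance] =ᵐ[P] 0)
    (hY0int : Integrable Y0 P) (hY1int : Integrable Y1 P)
    (hεYint : Integrable εY P) (hδint : Integrable δ P)
    (hlamint : ∀ i, Integrable (fun ω => lam ω i) P)
    (hrhoint : ∀ i, Integrable (fun ω => rho ω i) P)
    (hWint : ∀ i, Integrable (fun ω => W ω i) P)
    (hXint : ∀ i, Integrable (fun ω => X ω i) P)
    (hεWint : ∀ i, Integrable (fun ω => εW ω i) P)
    (hεXint : ∀ i, Integrable (fun ω => εX ω i) P)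
    (α : Fin N → ℝ) (hα : Γ.mulVec α = β)
    (γ : Fin H → ℝ) (hγ : Φ.mulVec γ = θ) :
    ∫ ω, (Y1 ω - W ω ⬝ᵥ α) ∂P = ∫ ω, X ω ⬝ᵥ γ ∂P ∧
    ∫ ω, (Y1 ω - W ω ⬝ᵥ α) ∂P = ∫ ω, (Y1 ω - Y0 ω) ∂P := by
  have hm : MeasurableSpace.comap (fun ω => (lam ω, rho ω)) inferInstance ≤ ‹MeasurableSpace Ω› :=
    (hlam.prodMk hrho).comap_le
  have hWY : ∫ ω, W ω ⬝ᵥ α ∂P = ∫ ω, Y0 ω ∂P :=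
    integral_weighted_outcome_eq hlamint hY0 hW hεYint hεWint
      (integral_eq_zero_of_condExp_ae_eq_zero hm hεY)
      (fun i => integral_eq_zero_of_condExp_ae_eq_zero hm (hεW i)) hα
  have hXY : ∫ ω, X ω ⬝ᵥ γ ∂P = ∫ ω, (Y1 ω - Y0 ω) ∂P :=
    integral_weighted_outcome_eq hrhoint hY1 hX hδint hεXint
      (integral_eq_zero_of_condExp_ae_eq_zero hm hδ)
      (fun i => integral_eq_zero_of_condExp_ae_eq_zero hm (hεX i)) hγ
  have hATT : ∫ ω, (Y1 ω - W ω ⬝ᵥ α) ∂P = ∫ ω, (Y1 ω - Y0 ω) ∂P := by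
    rw [integral_sub hY1int (integrable_dotProduct_const hWint α), integral_sub hY1int hY0int, hWY]
  exact ⟨hATT.trans hXY.symm, hATT⟩
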